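/- Suppose A, B, C, D ∈ End(ℂⁿ⊗ℂⁿ) satisfy the Yang–Baxter consistency relations and the unitarity conditions, and let T ∈ End(V)⊗R satisfy the quadratic exchange relation A₁₂T₁B₁₂T₂ = T₂C₁₂T₁D₁₂. Define, for each ordered label set M = ⟨1,…,m⟩, T_M := ∏→_{i∈M} ( T_i · ∏→_{j∈M, j>i} B_{ij} ) ∈ End(V^{⊗M})⊗R. Then for all disjoint ordered label sets M, N′ the fused exchange relation holds: A_{MN̄′} T_M B_{MN′} T_{N′} = T_{N′} C_{MN′} T_M D_{MN̄′}. -/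

import Mathlib

open Matrix

namespace QT

variable {n : ℕ} {ι : Type*} [Fintype ι] [DecidableEq ι] {α : Type*}
variable {R : Type*} [Ring R] [Algebra ℂ R]

/-- Operators on `V^{⊗ι}`, `V = ℂⁿ`, with entries in `α`. -/
abbrev Tens (ι : Type*) (n : ℕ) (α : Type*) := Matrix (ι → Fin n) (ι → Fin n) α

/-- Two-site matrices, i.e. elements of `End(V ⊗ V)` with entries in `α`. -/
abbrev M2 (n : ℕ) (α : Type*) := Matrix (Fin n × Fin n) (Fin n × Fin n) α

/-- `X_{ij}` : embedding of a two-site matrix at the (distinct) sites `i, j`,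
acting as the identity elsewhere. -/
noncomputable def emb2 [MulZeroOneClass α] (X : M2 n α) (i j : ι) : Tens ι n α :=
  Matrix.of fun f g =>
    if ∀ k, k ≠ i → k ≠ j → f k = g k then X (f i, f j) (g i, g j) else 0

/-- `T_i` : embedding of a one-site matrix at site `i`. -/
noncomputable def emb1 [Zero α] (T : Matrix (Fin n) (Fin n) α) (i : ι) : Tens ι n α :=
  Matrix.of fun f g => if ∀ k, k ≠ i → f k = g k then T (f i) (g i) else 0

/-- Fused matrix `X_{MN} = ∏→_{i∈M} ∏→_{j∈N} X_{ij}` (a bar, i.e. reversal of one of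
the ordered label sets, is obtained by passing `M.reverse` or `N.reverse`). -/
noncomputable def fuse [Semiring α] (X : M2 n α) (M N : List ι) : Tens ι n α :=
  (M.map fun i => (N.map fun j => emb2 X i j).prod).prod

/-- Partial transposition `t_S` in the factors labelled by `S`. -/
noncomputable def ptrans (S : Finset ι) (X : Tens ι n α) : Tens ι n α :=
  Matrix.of fun f g =>
    X (fun k => if k ∈ S then g k else f k) (fun k => if k ∈ S then f k else g k)

/-- Partial transposition `t₁` on a two-site matrix. -/
noncomputable def t1 (X : M2 n α) : M2 n α :=
  Matrix.of fun p q => X (q.1, p.2) (p.1, q.2)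

/-- Partial transposition `t₂` on a two-site matrix. -/
noncomputable def t2 (X : M2 n α) : M2 n α :=
  Matrix.of fun p q => X (p.1, q.2) (q.1, p.2)

/-- `X₂₁ = P X₁₂ P` : permutation of the two factors of a two-site matrix. -/
noncomputable def perm2 (X : M2 n α) : M2 n α :=
  Matrix.of fun p q => X (p.2, p.1) (q.2, q.1)

/-- The permutation (flip) matrix `P` on `V ⊗ V`. -/
noncomputable def PM (n : ℕ) (α : Type*) [Zero α] [One α] : M2 n α :=
  Matrix.of fun p q => if p.1 = q.2 ∧ p.2 = q.1 then 1 else 0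

/-- Index type for `V^{⊗M}`. -/
abbrev idx (n : ℕ) {ι : Type*} [DecidableEq ι] (M : List ι) :=
  {x // x ∈ M.toFinset} → Fin n

/-- Embedding `End(V^{⊗M}) ⊗ R → End(V^{⊗ι}) ⊗ R`, acting as the identity off `M`. -/
noncomputable def embS [Zero α] (M : List ι) (X : Matrix (idx n M) (idx n M) α) :
    Tens ι n α :=
  Matrix.of fun f g =>
    if ∀ k, k ∉ M.toFinset → f k = g k then
      X (fun i => f i.1) (fun i => g i.1) else 0

/-- A pair of disjoint ordered label sets. -/
def OkPair (M N : List ι) : Prop := M.Nodup ∧ N.Nodup ∧ M.Disjoint N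

/-- Fused solution `T_M = ∏→_{i∈M} ( T_i ∏→_{j∈M, j>i} B_{ij} )` of the quadratic
exchange algebra (also used for the dual fusion, with `B` replaced by the
appropriate dual structure matrix). -/
noncomputable def fuseT (B : M2 n ℂ) (T : Matrix (Fin n) (Fin n) R) :
    List ι → Tens ι n R
  | [] => 1
  | i :: M => emb1 T i *
      ((M.map fun j => (emb2 B i j).map (algebraMap ℂ R)).prod) * fuseT B T M

/-- The chain `X̌_{i₁i₂} X̌_{i₂i₃} ⋯ X̌_{i_{m-1}i_m}` along the ordered label set,
where `X̌_{ij} = P_{ij} X_{ij}`. -/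
noncomputable def chainCheck (X : M2 n ℂ) : List ι → Tens ι n ℂ
  | [] => 1
  | [_] => 1
  | i :: j :: M => emb2 (PM n ℂ * X) i j * chainCheck X (j :: M)

/-- The lexicographically ordered product `L_M = ∏_{i<j ∈ M} A_{ij}`. -/
noncomputable def lexA (A : M2 n ℂ) : List ι → Tens ι n ℂ
  | [] => 1
  | i :: M => (M.map fun j => emb2 A i j).prod * lexA A M

/-- DKM-type fused solution
`T̃_M = ∏→_{i∈M} ( (∏→_{j>i} A_{ij}) T_i (∏←_{j>i} B_{ij}) )`. -/
noncomputable def fuseT2 (A B : M2 n ℂ) (T : Matrix (Fin n) (Fin n) R) :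
    List ι → Tens ι n R
  | [] => 1
  | i :: M => ((M.map fun j => emb2 A i j).prod).map (algebraMap ℂ R) * emb1 T i *
      ((M.reverse.map fun j => emb2 B i j).prod).map (algebraMap ℂ R) * fuseT2 A B T M

/-! ### Dynamical setting -/

/-- the space of dynamical parameters `λ ∈ ℂⁿ`. -/
abbrev Lam (n : ℕ) := Fin n → ℂ

/-- standard basis vector `e_a` of `ℂⁿ`. -/
noncomputable def ee {n : ℕ} (a : Fin n) : Lam n := Pi.single a 1

/-- `Σ_{k∈S} e_{f k}` : the dynamical shift read off the indices at the factors in `S`. -/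
noncomputable def shL (S : Finset ι) (f : ι → Fin n) : Lam n := ∑ k ∈ S, ee (f k)

/-- The dynamical shift `X(λ + h_S)` of a matrix-valued function of `λ` (which is
assumed to act as the identity on the factors labelled by `S`). -/
noncomputable def dsh (S : Finset ι) (X : Lam n → Tens ι n α) : Lam n → Tens ι n α :=
  fun lam => Matrix.of fun f g => X (lam + shL S f) f g

/-- Dynamical structure matrices `ℂⁿ → End(V⊗V)`. -/
abbrev DSM (n : ℕ) := Lam n → M2 n ℂ

/-- Fused `A_{MN̄′}` (no dynamical shifts occur in the recursion for `A`). -/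
noncomputable def fuseAd (A : DSM n) (M N : List ι) : Lam n → Tens ι n ℂ :=
  fun lam => fuse (A lam) M N.reverse

/-- Fused `B_{MN′} = B_{1N′} ⋅ B_{M₀N′}(λ+h₁)`. -/
noncomputable def fuseBd (B : DSM n) : List ι → List ι → Lam n → Tens ι n ℂ
  | [], _ => fun _ => 1
  | i :: M, N => fun lam =>
      ((N.map fun j => emb2 (B lam) i j).prod) * dsh {i} (fuseBd B M N) lam

/-- Fused `C_{MN′} = C_{M1′} ⋅ C_{MN′₀}(λ+h_{1′})`. -/
noncomputable def fuseCd (C : DSM n) : List ι → List ι → Lam n → Tens ι n ℂ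
  | _, [] => fun _ => 1
  | M, j :: N => fun lam =>
      ((M.map fun i => emb2 (C lam) i j).prod) * dsh {j} (fuseCd C M N) lam

/-- Fused `D_{iN̄′} = D_{in′}(λ+h_{(1′,n′-1)}) ⋅ D_{i,(N̄′)₀}` (`Nr` is the reversed `N′`). -/
noncomputable def fuseD1 (D : DSM n) (i : ι) : List ι → Lam n → Tens ι n ℂ
  | [] => fun _ => 1
  | j :: Nr => fun lam =>
      dsh Nr.toFinset (fun mu => emb2 (D mu) i j) lam * fuseD1 D i Nr lam

/-- Fused `D_{MN̄′} = D_{1N̄′} ⋅ D_{M₀N̄′}(λ+h₁)`. -/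
noncomputable def fuseDd (D : DSM n) : List ι → List ι → Lam n → Tens ι n ℂ
  | [], _ => fun _ => 1
  | i :: M, N => fun lam => fuseD1 D i N.reverse lam * dsh {i} (fuseDd D M N) lam

/-- zero-weight condition on the first factor: `[B₁₂, h⊗1] = 0` for all diagonal `h`. -/
def WB (B : DSM n) : Prop := ∀ lam (d : Fin n → ℂ),
  B lam * Matrix.diagonal (fun p => d p.1) = Matrix.diagonal (fun p => d p.1) * B lam

/-- zero-weight condition on the second factor: `[C₁₂, 1⊗h] = 0` for all diagonal `h`. -/
def WC (C : DSM n) : Prop := ∀ lam (d : Fin n → ℂ),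
  C lam * Matrix.diagonal (fun p => d p.2) = Matrix.diagonal (fun p => d p.2) * C lam

/-- total zero-weight condition: `[D₁₂, h⊗1 + 1⊗h] = 0` for all diagonal `h`. -/
def WD (D : DSM n) : Prop := ∀ lam (d : Fin n → ℂ),
  D lam * Matrix.diagonal (fun p => d p.1 + d p.2)
    = Matrix.diagonal (fun p => d p.1 + d p.2) * D lam

/-- The four coupled semi-dynamical Yang–Baxter equations, on `V⊗V⊗V`. -/
def SDYB (A B C D : DSM n) : Prop :=
  (∀ lam, emb2 (ι := Fin 3) (A lam) 0 1 * emb2 (A lam) 0 2 * emb2 (A lam) 1 2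
      = emb2 (A lam) 1 2 * emb2 (A lam) 0 2 * emb2 (A lam) 0 1) ∧
  (∀ lam, dsh {2} (fun mu => emb2 (ι := Fin 3) (D mu) 0 1) lam * emb2 (D lam) 0 2 *
        dsh {0} (fun mu => emb2 (D mu) 1 2) lam
      = emb2 (D lam) 1 2 * dsh {1} (fun mu => emb2 (D mu) 0 2) lam * emb2 (D lam) 0 1) ∧
  (∀ lam, emb2 (ι := Fin 3) (D lam) 0 1 * emb2 (B lam) 0 2 *
        dsh {0} (fun mu => emb2 (B mu) 1 2) lam
      = emb2 (B lam) 1 2 * dsh {1} (fun mu => emb2 (B mu) 0 2) lam * emb2 (D lam) 0 1) ∧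
  (∀ lam, emb2 (ι := Fin 3) (A lam) 0 1 * emb2 (C lam) 0 2 * emb2 (C lam) 1 2
      = emb2 (C lam) 1 2 * emb2 (C lam) 0 2 * dsh {2} (fun mu => emb2 (A mu) 0 1) lam)

/-- Fused semi-dynamical solution
`T_M(λ) = ∏→_{i∈M} ( T_i(λ + h_{{k∈M : k<i}}) ∏→_{j∈M, j>i} B_{ij}(λ) )`. -/
noncomputable def fuseTd (B : DSM n) (T : Lam n → Matrix (Fin n) (Fin n) R)
    (M : List ι) : Lam n → Tens ι n R := fun lam =>
  (M.map fun i =>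
    dsh ((M.takeWhile (fun k => decide (k ≠ i))).toFinset)
        (fun mu => emb1 (T mu) i) lam *
    ((((M.dropWhile (fun k => decide (k ≠ i))).tail).map fun j =>
        emb2 (B lam) i j).prod).map (algebraMap ℂ R)).prod

/-- The relations used in the fusion procedure, for families of elements of a monoid indexed by
labels; the matrix `C` enters only through `B` since `C_{ij} = B_{ji}`. -/
structure ExchangeSystem {ι E : Type*} [Monoid E] (a b d : ι → ι → E) (t : ι → E) : Prop where
  comm_ab : ∀ {i j k l}, i ≠ k → i ≠ l → j ≠ k → j ≠ l → Commute (a i j) (b k l)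
  comm_bb : ∀ {i j k l}, i ≠ k → i ≠ l → j ≠ k → j ≠ l → Commute (b i j) (b k l)
  comm_db : ∀ {i j k l}, i ≠ k → i ≠ l → j ≠ k → j ≠ l → Commute (d i j) (b k l)
  comm_at : ∀ {i j k}, i ≠ k → j ≠ k → Commute (a i j) (t k)
  comm_bt : ∀ {i j k}, i ≠ k → j ≠ k → Commute (b i j) (t k)
  comm_dt : ∀ {i j k}, i ≠ k → j ≠ k → Commute (d i j) (t k)
  abb : ∀ {i j k}, i ≠ j → i ≠ k → j ≠ k → a i j * b k i * b k j = b k j * b k i * a i j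
  dbb : ∀ {i j k}, i ≠ j → i ≠ k → j ≠ k → d i j * b i k * b j k = b j k * b i k * d i j
  exch : ∀ {i j}, i ≠ j → a i j * t i * b i j * t j = t j * b j i * t i * d i j

section Abstract

variable {ι E : Type*} [Monoid E]

/-- The ordered product `∏→_{j∈N} x_{ij}`. -/
def rowProd (x : ι → ι → E) (i : ι) (N : List ι) : E := (N.map (x i)).prod

/-- The ordered product `∏→_{i∈M} ∏→_{j∈N} x_{ij}`. -/
def rectProd (x : ι → ι → E) (M N : List ι) : E := (M.map fun i => rowProd x i N).prod

/-- The fused product `∏→_{i∈M} (t_i ∏→_{j∈M, j>i} b_{ij})`. -/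
def fusedProd (b : ι → ι → E) (t : ι → E) : List ι → E
  | [] => 1
  | i :: M => t i * rowProd b i M * fusedProd b t M

@[simp] theorem rowProd_nil (x : ι → ι → E) (i : ι) : rowProd x i [] = 1 := rfl

@[simp] theorem rowProd_cons (x : ι → ι → E) (i j : ι) (N : List ι) :
    rowProd x i (j :: N) = x i j * rowProd x i N := by simp [rowProd]

theorem rowProd_reverse_cons (x : ι → ι → E) (i j : ι) (N : List ι) :
    rowProd x i (j :: N).reverse = rowProd x i N.reverse * x i j := by simp [rowProd]

@[simp] theorem rectProd_nil (x : ι → ι → E) (N : List ι) : rectProd x [] N = 1 := rfl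

@[simp] theorem rectProd_cons (x : ι → ι → E) (i : ι) (M N : List ι) :
    rectProd x (i :: M) N = rowProd x i N * rectProd x M N := by simp [rectProd]

@[simp] theorem fusedProd_nil (b : ι → ι → E) (t : ι → E) : fusedProd b t [] = 1 := rfl

@[simp] theorem fusedProd_cons (b : ι → ι → E) (t : ι → E) (i : ι) (M : List ι) :
    fusedProd b t (i :: M) = t i * rowProd b i M * fusedProd b t M := rfl

theorem commute_rowProd {x : ι → ι → E} {i : ι} {N : List ι} {y : E}
    (h : ∀ j ∈ N, Commute y (x i j)) : Commute y (rowProd x i N) := by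
  induction N with
  | nil => simp
  | cons j N ih =>
    rw [rowProd_cons]
    exact (h j (by simp)).mul_right (ih fun k hk => h k (by simp [hk]))

theorem commute_rectProd {x : ι → ι → E} {M N : List ι} {y : E}
    (h : ∀ i ∈ M, ∀ j ∈ N, Commute y (x i j)) : Commute y (rectProd x M N) := by
  induction M with
  | nil => simp
  | cons i M ih =>
    rw [rectProd_cons]
    exact (commute_rowProd (h i (by simp))).mul_right (ih fun k hk => h k (by simp [hk]))

theorem commute_fusedProd {b : ι → ι → E} {t : ι → E} {M : List ι} {y : E}
    (hb : ∀ i ∈ M, ∀ j ∈ M, Commute y (b i j)) (ht : ∀ i ∈ M, Commute y (t i)) :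
    Commute y (fusedProd b t M) := by
  induction M with
  | nil => simp
  | cons i M ih =>
    rw [fusedProd_cons]
    refine ((ht i (by simp)).mul_right (commute_rowProd fun j hj => ?_)).mul_right
      (ih (fun k hk l hl => ?_) fun k hk => ?_)
    · exact hb i (by simp) j (by simp [hj])
    · exact hb k (by simp [hk]) l (by simp [hl])
    · exact ht k (by simp [hk])

variable {a b d : ι → ι → E} {t : ι → E}

namespace ExchangeSystem

theorem row_abb (S : ExchangeSystem a b d t) {i k : ι} (hik : i ≠ k) {N : List ι}
    (hN : N.Nodup) (hi : i ∉ N) (hk : k ∉ N) :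
    rowProd a k N.reverse * b i k * rowProd b i N
      = rowProd b i N * b i k * rowProd a k N.reverse := by
  induction N with
  | nil => simp
  | cons l N ih =>
    simp only [List.mem_cons, not_or, List.nodup_cons] at hN hi hk
    have h₁ : rowProd a k N.reverse * b i l = b i l * rowProd a k N.reverse :=
      Commute.eq (Commute.symm (commute_rowProd fun j hj => by
        rw [List.mem_reverse] at hj
        exact Commute.symm (S.comm_ab hik.symm hk.1 (by grind) (by grind))))
    have h₂ : a k l * rowProd b i N = rowProd b i N * a k l :=
      Commute.eq (commute_rowProd fun j hj =>
        S.comm_ab hik.symm (by grind) (by grind) (by grind))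
    have h₃ := S.abb hk.1 hik.symm (Ne.symm hi.1)
    have h₄ := ih hN.2 hi.2 hk.2
    rw [rowProd_reverse_cons, rowProd_cons]
    generalize rowProd a k N.reverse = A at *
    generalize rowProd b i N = B at *
    calc A * a k l * b i k * (b i l * B) = A * (a k l * b i k * b i l) * B := by
          simp only [mul_assoc]
      _ = (A * b i l) * b i k * (a k l * B) := by rw [h₃]; simp only [mul_assoc]
      _ = b i l * (A * b i k * B) * a k l := by rw [h₁, h₂]; simp only [mul_assoc]
      _ = _ := by rw [h₄]; simp only [mul_assoc]

theorem rect_abb (S : ExchangeSystem a b d t) {i : ι} {M N : List ι}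
    (hN : N.Nodup) (hiM : i ∉ M) (hiN : i ∉ N) (hd : M.Disjoint N) (hM : M.Nodup) :
    rectProd a M N.reverse * rowProd b i M * rowProd b i N
      = rowProd b i N * rowProd b i M * rectProd a M N.reverse := by
  induction M with
  | nil => simp
  | cons k M ih =>
    simp only [List.mem_cons, not_or, List.nodup_cons, List.disjoint_cons_left] at hM hiM hd
    have hMN : ∀ x ∈ M, x ∉ N := fun x h h' => hd.2 h h'
    have h₁ : rectProd a M N.reverse * b i k = b i k * rectProd a M N.reverse :=
      Commute.eq (Commute.symm (commute_rectProd fun x hx y hy => by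
        rw [List.mem_reverse] at hy
        exact Commute.symm (S.comm_ab (by grind) (by grind) (by grind) (by grind))))
    have h₂ : rowProd a k N.reverse * rowProd b i M = rowProd b i M * rowProd a k N.reverse :=
      Commute.eq (commute_rowProd fun x hx => Commute.symm (commute_rowProd fun y hy => by
        rw [List.mem_reverse] at hy
        exact Commute.symm (S.comm_ab (by grind) (by grind) (by grind) (by grind))))
    have h₃ := S.row_abb hiM.1 hN hiN hd.1
    have h₄ := ih hiM.2 hd.2 hM.2
    simp only [rectProd_cons, rowProd_cons]
    generalize rowProd a k N.reverse = A at *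
    generalize rectProd a M N.reverse = A' at *
    generalize rowProd b i M = B at *
    generalize rowProd b i N = B' at *
    calc A * A' * (b i k * B) * B' = A * (A' * b i k) * B * B' := by simp only [mul_assoc]
      _ = A * b i k * (A' * B * B') := by rw [h₁]; simp only [mul_assoc]
      _ = (A * b i k * B') * B * A' := by rw [h₄]; simp only [mul_assoc]
      _ = B' * b i k * (A * B) * A' := by rw [h₃]; simp only [mul_assoc]
      _ = _ := by rw [h₂]; simp only [mul_assoc]

theorem row_dbb (S : ExchangeSystem a b d t) {i j : ι} (hij : i ≠ j) {N : List ι}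
    (hN : N.Nodup) (hi : i ∉ N) (hj : j ∉ N) :
    d i j * rowProd b i N * rowProd b j N = rowProd b j N * rowProd b i N * d i j := by
  induction N with
  | nil => simp
  | cons k N ih =>
    simp only [List.mem_cons, not_or, List.nodup_cons] at hN hi hj
    have h₁ : rowProd b i N * b j k = b j k * rowProd b i N :=
      Commute.eq (Commute.symm (commute_rowProd fun x hx =>
        S.comm_bb hij.symm (by grind) (by grind) (by grind)))
    have h₂ : rowProd b j N * b i k = b i k * rowProd b j N :=
      Commute.eq (Commute.symm (commute_rowProd fun x hx =>
        S.comm_bb hij (by grind) (by grind) (by grind)))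
    have h₃ := S.dbb hij hi.1 hj.1
    have h₄ := ih hN.2 hi.2 hj.2
    simp only [rowProd_cons]
    generalize rowProd b i N = B at *
    generalize rowProd b j N = B' at *
    calc d i j * (b i k * B) * (b j k * B') = d i j * b i k * (B * b j k) * B' := by
          simp only [mul_assoc]
      _ = (d i j * b i k * b j k) * B * B' := by rw [h₁]; simp only [mul_assoc]
      _ = b j k * b i k * (d i j * B * B') := by rw [h₃]; simp only [mul_assoc]
      _ = b j k * (b i k * B') * B * d i j := by rw [h₄]; simp only [mul_assoc]
      _ = _ := by rw [← h₂]; simp only [mul_assoc]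

theorem col_dbb (S : ExchangeSystem a b d t) {i k : ι} (hik : i ≠ k) {N : List ι}
    (hN : N.Nodup) (hi : i ∉ N) (hk : k ∉ N) :
    rowProd d i N.reverse * b i k * rowProd (fun x y => b y x) k N
      = rowProd (fun x y => b y x) k N * b i k * rowProd d i N.reverse := by
  induction N with
  | nil => simp
  | cons l N ih =>
    simp only [List.mem_cons, not_or, List.nodup_cons] at hN hi hk
    have h₁ : rowProd d i N.reverse * b l k = b l k * rowProd d i N.reverse :=
      Commute.eq (Commute.symm (commute_rowProd fun j hj => by
        rw [List.mem_reverse] at hj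
        exact Commute.symm (S.comm_db hi.1 hik (by grind) (by grind))))
    have h₂ : d i l * rowProd (fun x y => b y x) k N
        = rowProd (fun x y => b y x) k N * d i l :=
      Commute.eq (commute_rowProd fun j hj =>
        S.comm_db (by grind) (by grind) (by grind) (by grind))
    have h₃ := S.dbb hi.1 hik (Ne.symm hk.1)
    have h₄ := ih hN.2 hi.2 hk.2
    rw [rowProd_reverse_cons, rowProd_cons]
    generalize rowProd d i N.reverse = D at *
    generalize rowProd (fun x y => b y x) k N = B at *
    calc D * d i l * b i k * (b l k * B) = D * (d i l * b i k * b l k) * B := by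
          simp only [mul_assoc]
      _ = (D * b l k) * b i k * (d i l * B) := by rw [h₃]; simp only [mul_assoc]
      _ = b l k * (D * b i k * B) * d i l := by rw [h₁, h₂]; simp only [mul_assoc]
      _ = _ := by rw [h₄]; simp only [mul_assoc]

theorem rect_dbb (S : ExchangeSystem a b d t) {i : ι} {M N : List ι}
    (hN : N.Nodup) (hiM : i ∉ M) (hiN : i ∉ N) (hd : M.Disjoint N) (hM : M.Nodup) :
    rowProd d i N.reverse * rowProd b i M * rectProd (fun x y => b y x) M N
      = rectProd (fun x y => b y x) M N * rowProd b i M * rowProd d i N.reverse := by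
  induction M with
  | nil => simp
  | cons k M ih =>
    simp only [List.mem_cons, not_or, List.nodup_cons, List.disjoint_cons_left] at hM hiM hd
    have hMN : ∀ x ∈ M, x ∉ N := fun x h h' => hd.2 h h'
    have h₁ : rowProd b i M * rowProd (fun x y => b y x) k N
        = rowProd (fun x y => b y x) k N * rowProd b i M :=
      Commute.eq (commute_rowProd fun x hx => Commute.symm (commute_rowProd fun y hy =>
        S.comm_bb (by grind) (by grind) (by grind) (by grind)))
    have h₂ : b i k * rectProd (fun x y => b y x) M N
        = rectProd (fun x y => b y x) M N * b i k :=
      Commute.eq (commute_rectProd fun x hx y hy =>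
        S.comm_bb (by grind) (by grind) (by grind) (by grind))
    have h₃ := S.col_dbb hiM.1 hN hiN hd.1
    have h₄ := ih hiM.2 hd.2 hM.2
    simp only [rectProd_cons, rowProd_cons]
    generalize rowProd d i N.reverse = D at *
    generalize rectProd (fun x y => b y x) M N = C at *
    generalize rowProd (fun x y => b y x) k N = C' at *
    generalize rowProd b i M = B at *
    calc D * (b i k * B) * (C' * C) = D * b i k * (B * C') * C := by simp only [mul_assoc]
      _ = (D * b i k * C') * B * C := by rw [h₁]; simp only [mul_assoc]
      _ = C' * b i k * (D * B * C) := by rw [h₃]; simp only [mul_assoc]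
      _ = C' * (b i k * C) * B * D := by rw [h₄]; simp only [mul_assoc]
      _ = _ := by rw [h₂]; simp only [mul_assoc]

theorem row_exch (S : ExchangeSystem a b d t) {i : ι} {N : List ι} (hN : N.Nodup)
    (hi : i ∉ N) :
    rowProd a i N.reverse * t i * rowProd b i N * fusedProd b t N
      = fusedProd b t N * rowProd (fun x y => b y x) i N * t i * rowProd d i N.reverse := by
  induction N with
  | nil => simp
  | cons j N ih =>
    simp only [List.mem_cons, not_or, List.nodup_cons] at hN hi
    have h₁ : rowProd b i N * t j = t j * rowProd b i N :=
      Commute.eq (Commute.symm (commute_rowProd fun x hx =>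
        Commute.symm (S.comm_bt (by grind) (by grind))))
    have h₂ : rowProd a i N.reverse * t j = t j * rowProd a i N.reverse :=
      Commute.eq (Commute.symm (commute_rowProd fun x hx => by
        rw [List.mem_reverse] at hx
        exact Commute.symm (S.comm_at (by grind) (by grind))))
    have h₃ : t i * rowProd b j N = rowProd b j N * t i :=
      Commute.eq (commute_rowProd fun x hx => Commute.symm (S.comm_bt (by grind) (by grind)))
    have h₄ : d i j * fusedProd b t N = fusedProd b t N * d i j :=
      Commute.eq (commute_fusedProd
        (fun x hx y hy => S.comm_db (by grind) (by grind) (by grind) (by grind))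
        (fun x hx => S.comm_dt (by grind) (by grind)))
    have h₅ : b j i * fusedProd b t N = fusedProd b t N * b j i :=
      Commute.eq (commute_fusedProd
        (fun x hx y hy => S.comm_bb (by grind) (by grind) (by grind) (by grind))
        (fun x hx => S.comm_bt (by grind) (by grind)))
    have h₆ := S.row_abb (Ne.symm hi.1) hN.2 hN.1 hi.2
    have h₇ := S.row_dbb hi.1 hN.2 hi.2 hN.1
    have h₈ := S.exch hi.1
    have h₉ := ih hN.2 hi.2
    simp only [rowProd_reverse_cons, rowProd_cons, fusedProd_cons]
    generalize rowProd a i N.reverse = A at *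
    generalize rowProd d i N.reverse = D at *
    generalize rowProd (fun x y => b y x) i N = C at *
    generalize rowProd b i N = B at *
    generalize rowProd b j N = B' at *
    generalize fusedProd b t N = F at *
    calc A * a i j * t i * (b i j * B) * (t j * B' * F)
        = A * a i j * t i * b i j * (B * t j) * B' * F := by simp only [mul_assoc]
      _ = A * (a i j * t i * b i j * t j) * B * B' * F := by rw [h₁]; simp only [mul_assoc]
      _ = (A * t j) * b j i * t i * (d i j * B * B') * F := by rw [h₈]; simp only [mul_assoc]
      _ = t j * A * b j i * (t i * B') * B * (d i j * F) := by
          rw [h₂, h₇]; simp only [mul_assoc]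
      _ = t j * (A * b j i * B') * t i * B * F * d i j := by
          rw [h₃, h₄]; simp only [mul_assoc]
      _ = t j * B' * b j i * (A * t i * B * F) * d i j := by rw [h₆]; simp only [mul_assoc]
      _ = t j * B' * (b j i * F) * C * t i * D * d i j := by rw [h₉]; simp only [mul_assoc]
      _ = _ := by rw [h₅]; simp only [mul_assoc]

theorem rect_exch (S : ExchangeSystem a b d t) {M N : List ι} (hM : M.Nodup) (hN : N.Nodup)
    (hd : M.Disjoint N) :
    rectProd a M N.reverse * fusedProd b t M * rectProd b M N * fusedProd b t N
      = fusedProd b t N * rectProd (fun x y => b y x) M N * fusedProd b t M *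
        rectProd d M N.reverse := by
  induction M with
  | nil => simp
  | cons i M ih =>
    simp only [List.nodup_cons, List.disjoint_cons_left] at hM hd
    have hMN : ∀ x ∈ M, x ∉ N := fun x h h' => hd.2 h h'
    have h₁ : rectProd a M N.reverse * t i = t i * rectProd a M N.reverse :=
      Commute.eq (Commute.symm (commute_rectProd fun x hx y hy => by
        rw [List.mem_reverse] at hy
        exact Commute.symm (S.comm_at (by grind) (by grind))))
    have h₂ : fusedProd b t M * rowProd b i N = rowProd b i N * fusedProd b t M :=
      Commute.eq (commute_rowProd fun x hx => Commute.symm (commute_fusedProd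
        (fun y hy z hz => S.comm_bb (by grind) (by grind) (by grind) (by grind))
        (fun y hy => S.comm_bt (by grind) (by grind))))
    have h₃ : rowProd b i M * fusedProd b t N = fusedProd b t N * rowProd b i M :=
      Commute.eq (commute_fusedProd
        (fun y hy z hz => Commute.symm (commute_rowProd fun x hx =>
          S.comm_bb (by grind) (by grind) (by grind) (by grind)))
        (fun y hy => Commute.symm (commute_rowProd fun x hx =>
          Commute.symm (S.comm_bt (by grind) (by grind)))))
    have h₄ : t i * rectProd (fun x y => b y x) M N
        = rectProd (fun x y => b y x) M N * t i :=
      Commute.eq (commute_rectProd fun x hx y hy => Commute.symm (S.comm_bt (by grind) (by grind)))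
    have h₅ : rowProd d i N.reverse * fusedProd b t M
        = fusedProd b t M * rowProd d i N.reverse :=
      Commute.eq (Commute.symm (commute_rowProd fun x hx => Commute.symm (commute_fusedProd
        (fun y hy z hz => by
          rw [List.mem_reverse] at hx
          exact S.comm_db (by grind) (by grind) (by grind) (by grind))
        (fun y hy => by
          rw [List.mem_reverse] at hx
          exact S.comm_dt (by grind) (by grind)))))
    have h₆ := S.rect_abb hN hM.1 hd.1 hd.2 hM.2
    have h₇ := S.rect_dbb hN hM.1 hd.1 hd.2 hM.2
    have h₈ := S.row_exch hN hd.1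
    have h₉ := ih hM.2 hd.2
    simp only [rectProd_cons, fusedProd_cons]
    generalize rowProd a i N.reverse = A at *
    generalize rectProd a M N.reverse = A' at *
    generalize rowProd d i N.reverse = D at *
    generalize rectProd d M N.reverse = D' at *
    generalize rowProd (fun x y => b y x) i N = C at *
    generalize rectProd (fun x y => b y x) M N = C' at *
    generalize rowProd b i N = B at *
    generalize rectProd b M N = B' at *
    generalize rowProd b i M = B'' at *
    generalize fusedProd b t N = F at *
    generalize fusedProd b t M = G at *
    calc A * A' * (t i * B'' * G) * (B * B') * F
        = A * (A' * t i) * B'' * (G * B) * B' * F := by simp only [mul_assoc]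
      _ = A * t i * (A' * B'' * B) * G * B' * F := by rw [h₁, h₂]; simp only [mul_assoc]
      _ = A * t i * B * B'' * (A' * G * B' * F) := by rw [h₆]; simp only [mul_assoc]
      _ = A * t i * B * (B'' * F) * C' * G * D' := by rw [h₉]; simp only [mul_assoc]
      _ = (A * t i * B * F) * B'' * C' * G * D' := by rw [h₃]; simp only [mul_assoc]
      _ = F * C * t i * (D * B'' * C') * G * D' := by rw [h₈]; simp only [mul_assoc]
      _ = F * C * (t i * C') * B'' * (D * G) * D' := by rw [h₇]; simp only [mul_assoc]
      _ = _ := by rw [h₄, h₅]; simp only [mul_assoc]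

end ExchangeSystem

end Abstract

section Embedding

variable {n : ℕ} {ι κ : Type*} {α β : Type*}

/-- The matrix `P` acts as the identity off the set `S` of tensor factors. -/
structure ActsOn [Zero α] (S : Set ι) (P : Tens ι n α) : Prop where
  eq_zero : ∀ {f g}, ¬ Set.EqOn f g Sᶜ → P f g = 0
  congr : ∀ {f g f' g'}, Set.EqOn f f' S → Set.EqOn g g' S → Set.EqOn f g Sᶜ →
    Set.EqOn f' g' Sᶜ → P f g = P f' g'

theorem ActsOn.map [Zero α] [Zero β] {S : Set ι} {P : Tens ι n α} (h : ActsOn S P)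
    (φ : α → β) (hφ : φ 0 = 0) : ActsOn S (P.map φ) where
  eq_zero hfg := by rw [Matrix.map_apply, h.eq_zero hfg, hφ]
  congr h₁ h₂ h₃ h₄ := by rw [Matrix.map_apply, Matrix.map_apply, h.congr h₁ h₂ h₃ h₄]

variable [Fintype ι] [DecidableEq ι]

theorem actsOn_emb2 [MulZeroOneClass α] (X : M2 n α) (i j : ι) :
    ActsOn {i, j} (emb2 X i j) where
  eq_zero {f g} h := if_neg fun h' => h fun k hk => by
    simp only [Set.mem_compl_iff, Set.mem_insert_iff, Set.mem_singleton_iff, not_or] at hk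
    exact h' k hk.1 hk.2
  congr {f g f' g'} hf hg h h' := by
    have H : ∀ {u v : ι → Fin n}, Set.EqOn u v {i, j}ᶜ → ∀ k, k ≠ i → k ≠ j → u k = v k :=
      fun huv k hi hj => huv (by simp [hi, hj])
    simp only [emb2, Matrix.of_apply, if_pos (H h), if_pos (H h')]
    rw [hf (by simp : i ∈ _), hf (by simp : j ∈ _), hg (by simp : i ∈ _), hg (by simp : j ∈ _)]

theorem actsOn_emb1 [Zero α] (T : Matrix (Fin n) (Fin n) α) (i : ι) :
    ActsOn {i} (emb1 T i) where
  eq_zero {f g} h := if_neg fun h' => h fun k hk => h' k hk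
  congr {f g f' g'} hf hg h h' := by
    have H : ∀ {u v : ι → Fin n}, Set.EqOn u v {i}ᶜ → ∀ k, k ≠ i → u k = v k :=
      fun huv k hi => huv hi
    simp only [emb1, Matrix.of_apply, if_pos (H h), if_pos (H h')]
    rw [hf (by simp : i ∈ _), hg (by simp : i ∈ _)]

open Classical in
theorem ActsOn.mul_apply [NonUnitalNonAssocSemiring α] {S S' : Set ι} {P Q : Tens ι n α}
    (hP : ActsOn S P) (hQ : ActsOn S' Q) (hS : Disjoint S S') (f g : ι → Fin n) :
    (P * Q) f g = P f (S.piecewise g f) * Q (S.piecewise g f) g := by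
  rw [Matrix.mul_apply]
  refine Finset.sum_eq_single _ (fun h _ hne => ?_) (by simp)
  by_cases h₁ : Set.EqOn f h Sᶜ
  · by_cases h₂ : Set.EqOn h g S'ᶜ
    · refine (hne (funext fun k => ?_)).elim
      by_cases hk : k ∈ S
      · rw [Set.piecewise_eq_of_mem _ _ _ hk]
        exact h₂ (hS.notMem_of_mem_left hk)
      · rw [Set.piecewise_eq_of_notMem _ _ _ hk]
        exact (h₁ hk).symm
    · rw [hQ.eq_zero h₂, mul_zero]
  · rw [hP.eq_zero h₁, zero_mul]

open Classical in
theorem ActsOn.commute [NonUnitalNonAssocSemiring α] {S S' : Set ι} {P Q : Tens ι n α}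
    (hP : ActsOn S P) (hQ : ActsOn S' Q) (hS : Disjoint S S')
    (h : ∀ f g f' g', Commute (P f g) (Q f' g')) : Commute P Q := by
  ext f g
  rw [hP.mul_apply hQ hS, hQ.mul_apply hP hS.symm, (h _ _ _ _).eq]
  have hS₁ : ∀ k ∈ S, k ∉ S' := fun k hk => hS.notMem_of_mem_left hk
  by_cases hfg : Set.EqOn f g (S ∪ S')ᶜ
  · have hfg' : ∀ k, k ∉ S → k ∉ S' → f k = g k := fun k h₁ h₂ => hfg (by simp [h₁, h₂])
    congr 1
    · apply hQ.congr <;> intro k hk <;> simp only [Set.piecewise] <;> grind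
    · apply hP.congr <;> intro k hk <;> simp only [Set.piecewise] <;> grind
  · have : ∃ k, k ∉ S ∧ k ∉ S' ∧ f k ≠ g k := by
      by_contra! hc
      exact hfg fun k hk => by
        simp only [Set.mem_compl_iff, Set.mem_union, not_or] at hk
        exact hc k hk.1 hk.2
    obtain ⟨k, hk, hk', hne⟩ := this
    rw [hQ.eq_zero fun h' => hne (by simpa [hk] using h' hk'),
      hP.eq_zero (f := S'.piecewise g f) (g := g) fun h' => hne (by simpa [hk'] using h' hk)]
    simp

/-- The embedding `End(V^{⊗κ}) → End(V^{⊗ι})` along a map `σ : κ → ι` of labels, acting as the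
identity off the range of `σ`. -/
noncomputable def embAlong [Fintype κ] [Zero α] (σ : κ → ι) (X : Tens κ n α) : Tens ι n α :=
  Matrix.of fun f g =>
    if ∀ k, (∀ x, k ≠ σ x) → f k = g k then X (f ∘ σ) (g ∘ σ) else 0

theorem embAlong_mul [NonUnitalNonAssocSemiring α] [Fintype κ] [DecidableEq κ] {σ : κ → ι}
    (hσ : Function.Injective σ) (X Y : Tens κ n α) :
    embAlong σ (X * Y) = embAlong σ X * embAlong σ Y := by
  ext f g
  have hout : ∀ (u : κ → Fin n) k, (∀ x, k ≠ σ x) → Function.extend σ u f k = f k :=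
    fun u k hk => Function.extend_apply' _ _ _ fun ⟨x, hx⟩ => hk x hx.symm
  have hcomp : ∀ u : κ → Fin n, Function.extend σ u f ∘ σ = u :=
    fun u => funext fun x => hσ.extend_apply _ _ _
  have hinj : Function.Injective fun u : κ → Fin n => Function.extend σ u f :=
    fun u v huv => by rw [← hcomp u, ← hcomp v]; exact congrArg (· ∘ σ) huv
  rw [Matrix.mul_apply]
  rw [← Fintype.sum_of_injective _ hinj
    (fun u => if ∀ k, (∀ x, k ≠ σ x) → f k = g k then X (f ∘ σ) u * Y u (g ∘ σ) else 0)]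
  · simp only [embAlong, Matrix.of_apply]
    split_ifs
    · exact Matrix.mul_apply
    · simp
  · intro h hh
    by_cases h₁ : ∀ k, (∀ x, k ≠ σ x) → f k = h k
    · refine (hh ⟨h ∘ σ, funext fun k => ?_⟩).elim
      by_cases hk : ∃ x, σ x = k
      · obtain ⟨x, rfl⟩ := hk
        exact hσ.extend_apply _ _ _
      · have hk' : ∀ x, k ≠ σ x := fun x hx => hk ⟨x, hx.symm⟩
        exact (hout _ k hk').trans (h₁ k hk')
    · simp [embAlong, if_neg h₁]
  · intro u
    have h₁ : ∀ k, (∀ x, k ≠ σ x) → f k = Function.extend σ u f k :=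
      fun k hk => (hout u k hk).symm
    have h₂ : (∀ k, (∀ x, k ≠ σ x) → Function.extend σ u f k = g k) ↔
        ∀ k, (∀ x, k ≠ σ x) → f k = g k :=
      forall₂_congr fun k hk => by rw [hout u k hk]
    simp only [embAlong, Matrix.of_apply, if_pos h₁, h₂, hcomp, mul_ite, mul_zero]

theorem embAlong_map [Fintype κ] [Zero α] [Zero β] (σ : κ → ι) (X : Tens κ n α) (φ : α → β)
    (hφ : φ 0 = 0) : embAlong σ (X.map φ) = (embAlong σ X).map φ := by
  ext f g
  simp only [embAlong, Matrix.of_apply, Matrix.map_apply]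
  split_ifs <;> simp [hφ]

theorem embAlong_emb2 [MulZeroOneClass α] [Fintype κ] [DecidableEq κ] {σ : κ → ι}
    (hσ : Function.Injective σ) (X : M2 n α) (i j : κ) :
    embAlong σ (emb2 X i j) = emb2 X (σ i) (σ j) := by
  ext f g
  simp only [embAlong, emb2, Matrix.of_apply, Function.comp_apply, ← ite_and]
  refine if_congr ⟨fun ⟨h₁, h₂⟩ k hi hj => ?_, fun h => ⟨fun k hk => h k (hk i) (hk j),
    fun x hi hj => h _ (hσ.ne hi) (hσ.ne hj)⟩⟩ rfl rfl
  by_cases hk : ∃ x, k = σ x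
  · obtain ⟨x, rfl⟩ := hk
    exact h₂ x (fun h => hi (h ▸ rfl)) (fun h => hj (h ▸ rfl))
  · exact h₁ k fun x hx => hk ⟨x, hx⟩

theorem embAlong_emb1 [Zero α] [Fintype κ] [DecidableEq κ] {σ : κ → ι}
    (hσ : Function.Injective σ) (T : Matrix (Fin n) (Fin n) α) (i : κ) :
    embAlong σ (emb1 T i) = emb1 T (σ i) := by
  ext f g
  simp only [embAlong, emb1, Matrix.of_apply, Function.comp_apply, ← ite_and]
  refine if_congr ⟨fun ⟨h₁, h₂⟩ k hi => ?_, fun h => ⟨fun k hk => h k (hk i),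
    fun x hi => h _ (hσ.ne hi)⟩⟩ rfl rfl
  by_cases hk : ∃ x, k = σ x
  · obtain ⟨x, rfl⟩ := hk
    exact h₂ x fun h => hi (h ▸ rfl)
  · exact h₁ k fun x hx => hk ⟨x, hx⟩

theorem emb2_perm2 [MulZeroOneClass α] (X : M2 n α) (i j : ι) :
    emb2 (perm2 X) i j = emb2 X j i := by
  ext f g
  simp only [emb2, perm2, Matrix.of_apply]
  exact if_congr (forall_congr' fun k => ⟨fun h hj hi => h hi hj, fun h hi hj => h hj hi⟩)
    rfl rfl

end Embedding

section Fusion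

variable {n : ℕ} {ι : Type*} [Fintype ι] [DecidableEq ι]
variable {R : Type*} [Ring R] [Algebra ℂ R]

theorem fuse_map_eq_rectProd (X : M2 n ℂ) (M N : List ι) :
    (fuse X M N).map (algebraMap ℂ R)
      = rectProd (fun i j => (emb2 X i j).map (algebraMap ℂ R)) M N := by
  change (algebraMap ℂ R).mapMatrix (fuse X M N) = _
  simp only [fuse, rectProd, rowProd, map_list_prod, List.map_map, Function.comp_def]
  rfl

theorem fuseT_eq_fusedProd (B : M2 n ℂ) (T : Matrix (Fin n) (Fin n) R) (M : List ι) :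
    fuseT B T M
      = fusedProd (fun i j => (emb2 B i j).map (algebraMap ℂ R)) (fun i => emb1 T i) M := by
  induction M with
  | nil => rfl
  | cons i M ih => rw [fuseT, ih]; rfl

theorem commute_emb2_map (X Y : M2 n ℂ) {i j k l : ι} (hik : i ≠ k) (hil : i ≠ l)
    (hjk : j ≠ k) (hjl : j ≠ l) :
    Commute ((emb2 X i j).map (algebraMap ℂ R)) ((emb2 Y k l).map (algebraMap ℂ R)) := by
  have hX := (actsOn_emb2 X i j).map (algebraMap ℂ R) (map_zero _)
  have hY := (actsOn_emb2 Y k l).map (algebraMap ℂ R) (map_zero _)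
  refine hX.commute hY (by simp [hik.symm, hil.symm, hjk.symm, hjl.symm]) fun f g f' g' => ?_
  rw [Matrix.map_apply]
  exact Algebra.commute_algebraMap_left _ _

theorem commute_emb2_map_emb1 (X : M2 n ℂ) (T : Matrix (Fin n) (Fin n) R) {i j k : ι}
    (hik : i ≠ k) (hjk : j ≠ k) :
    Commute ((emb2 X i j).map (algebraMap ℂ R)) (emb1 T k) := by
  have hX := (actsOn_emb2 X i j).map (algebraMap ℂ R) (map_zero _)
  refine hX.commute (actsOn_emb1 T k) (by simp [hik.symm, hjk.symm]) fun f g f' g' => ?_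
  rw [Matrix.map_apply]
  exact Algebra.commute_algebraMap_left _ _

/-- A three-site relation of Yang–Baxter type holds at any three distinct labels. -/
theorem emb2_triple_of_fin {X Y Z X' Y' Z' : M2 n ℂ}
    (h : emb2 (ι := Fin 3) X 0 1 * emb2 Y 0 2 * emb2 Z 1 2
      = emb2 Z' 1 2 * emb2 Y' 0 2 * emb2 X' 0 1)
    {i j k : ι} (hij : i ≠ j) (hik : i ≠ k) (hjk : j ≠ k) :
    (emb2 X i j).map (algebraMap ℂ R) * (emb2 Y i k).map (algebraMap ℂ R) *
        (emb2 Z j k).map (algebraMap ℂ R)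
      = (emb2 Z' j k).map (algebraMap ℂ R) * (emb2 Y' i k).map (algebraMap ℂ R) *
        (emb2 X' i j).map (algebraMap ℂ R) := by
  have hσ : Function.Injective ![i, j, k] := by
    intro x y
    fin_cases x <;> fin_cases y <;> simp [hij, hik, hjk, hij.symm, hik.symm, hjk.symm]
  have h' := congrArg (embAlong ![i, j, k]) h
  simp only [embAlong_mul hσ, embAlong_emb2 hσ] at h'
  have h'' := congrArg (fun P => P.map (algebraMap ℂ R)) h'
  simp only [Matrix.map_mul] at h''
  exact h''

/-- The quadratic exchange relation holds at any two distinct labels. -/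
theorem exchange_of_fin {A B C D : M2 n ℂ} {T : Matrix (Fin n) (Fin n) R}
    (hT : (emb2 (ι := Fin 2) A 0 1).map (algebraMap ℂ R) * emb1 T 0 *
            (emb2 B 0 1).map (algebraMap ℂ R) * emb1 T 1
        = emb1 T 1 * (emb2 C 0 1).map (algebraMap ℂ R) * emb1 T 0 *
            (emb2 D 0 1).map (algebraMap ℂ R))
    {i j : ι} (hij : i ≠ j) :
    (emb2 A i j).map (algebraMap ℂ R) * emb1 T i *
        (emb2 B i j).map (algebraMap ℂ R) * emb1 T j
      = emb1 T j * (emb2 C i j).map (algebraMap ℂ R) * emb1 T i *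
        (emb2 D i j).map (algebraMap ℂ R) := by
  have hσ : Function.Injective ![i, j] := by
    intro x y
    fin_cases x <;> fin_cases y <;> simp [hij, hij.symm]
  have h' := congrArg (embAlong ![i, j]) hT
  simp only [embAlong_mul hσ, embAlong_map _ _ _ (map_zero (algebraMap ℂ R)),
    embAlong_emb2 hσ, embAlong_emb1 hσ] at h'
  exact h'

theorem exchangeSystem_of_fin {A B C D : M2 n ℂ}
    (hYBAC : emb2 (ι := Fin 3) A 0 1 * emb2 C 0 2 * emb2 C 1 2
          = emb2 C 1 2 * emb2 C 0 2 * emb2 A 0 1)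
    (hYBDB : emb2 (ι := Fin 3) D 0 1 * emb2 B 0 2 * emb2 B 1 2
          = emb2 B 1 2 * emb2 B 0 2 * emb2 D 0 1)
    (hBC : B = perm2 C) {T : Matrix (Fin n) (Fin n) R}
    (hT : (emb2 (ι := Fin 2) A 0 1).map (algebraMap ℂ R) * emb1 T 0 *
            (emb2 B 0 1).map (algebraMap ℂ R) * emb1 T 1
        = emb1 T 1 * (emb2 C 0 1).map (algebraMap ℂ R) * emb1 T 0 *
            (emb2 D 0 1).map (algebraMap ℂ R)) :
    ExchangeSystem (fun i j : ι => (emb2 A i j).map (algebraMap ℂ R))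
      (fun i j => (emb2 B i j).map (algebraMap ℂ R))
      (fun i j => (emb2 D i j).map (algebraMap ℂ R)) (fun i => emb1 T i) where
  comm_ab := commute_emb2_map A B
  comm_bb := commute_emb2_map B B
  comm_db := commute_emb2_map D B
  comm_at := commute_emb2_map_emb1 A T
  comm_bt := commute_emb2_map_emb1 B T
  comm_dt := commute_emb2_map_emb1 D T
  abb hij hik hjk := by
    simpa only [hBC, emb2_perm2] using emb2_triple_of_fin (R := R) hYBAC hij hik hjk
  dbb := emb2_triple_of_fin hYBDB
  exch hij := by
    simpa only [hBC, emb2_perm2] using exchange_of_fin hT hij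

end Fusion

/-- fusion of the quadratic exchange relation. -/
theorem fused_exchange_relation {n : ℕ} (hn : 1 ≤ n)
    {R : Type*} [Ring R] [Algebra ℂ R]
    (A B C D : M2 n ℂ)
    (hYBA : emb2 (ι := Fin 3) A 0 1 * emb2 A 0 2 * emb2 A 1 2
          = emb2 A 1 2 * emb2 A 0 2 * emb2 A 0 1)
    (hYBAC : emb2 (ι := Fin 3) A 0 1 * emb2 C 0 2 * emb2 C 1 2
          = emb2 C 1 2 * emb2 C 0 2 * emb2 A 0 1)
    (hYBD : emb2 (ι := Fin 3) D 0 1 * emb2 D 0 2 * emb2 D 1 2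
          = emb2 D 1 2 * emb2 D 0 2 * emb2 D 0 1)
    (hYBDB : emb2 (ι := Fin 3) D 0 1 * emb2 B 0 2 * emb2 B 1 2
          = emb2 B 1 2 * emb2 B 0 2 * emb2 D 0 1)
    (hUA : A * perm2 A = 1) (hUD : D * perm2 D = 1) (hBC : B = perm2 C)
    (T : Matrix (Fin n) (Fin n) R)
    (hT : (emb2 (ι := Fin 2) A 0 1).map (algebraMap ℂ R) * emb1 T 0 *
            (emb2 B 0 1).map (algebraMap ℂ R) * emb1 T 1
        = emb1 T 1 * (emb2 C 0 1).map (algebraMap ℂ R) * emb1 T 0 *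
            (emb2 D 0 1).map (algebraMap ℂ R))
    {ι : Type} [Fintype ι] [DecidableEq ι] (M N : List ι) (hMN : OkPair M N) :
    (fuse A M N.reverse).map (algebraMap ℂ R) * fuseT B T M *
      (fuse B M N).map (algebraMap ℂ R) * fuseT B T N
    = fuseT B T N * (fuse C M N).map (algebraMap ℂ R) * fuseT B T M *
      (fuse D M N.reverse).map (algebraMap ℂ R) := by
  have h := (exchangeSystem_of_fin (ι := ι) hYBAC hYBDB hBC hT).rect_exch hMN.1 hMN.2.1 hMN.2.2
  have hC : (fun i j : ι => (emb2 B j i).map (algebraMap ℂ R))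
      = fun i j => (emb2 C i j).map (algebraMap ℂ R) := by
    simp only [hBC, emb2_perm2]
  rw [hC] at h
  simp only [fuse_map_eq_rectProd, fuseT_eq_fusedProd]
  exact h

end QT
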